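/- Let p be a prime and let B be a blocking set in PG(2,p^3) that does not contain all the points of any line. Then |B| ≥ p^3 + p^2 + 1. -/

import Mathlib

open Module

namespace BlockingSet

open Polynomial

section Lacunary

variable {F : Type*} [Field F]

/-- A polynomial whose derivative vanishes is a `p`-th power over a finite field of
characteristic `p`. -/
lemma exists_eq_pow_of_derivative_eq_zero [Finite F] (p : ℕ) [Fact p.Prime] [CharP F p]
    {f : F[X]} (hf : derivative f = 0) : ∃ g : F[X], f = g ^ p := by
  have : ExpChar F p := ExpChar.prime Fact.out
  refine ⟨(contract p f).map (frobeniusEquiv F p).symm, ?_⟩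
  rw [← polynomial_expand_eq, expand_contract p hf (Fact.out : p.Prime).ne_zero]

/-- The degree bound of Blokhuis for a fully reducible lacunary polynomial `X ^ Q * g + h`. -/
lemma natDegree_le_of_splits_lacunary [Fintype F] {Q r : ℕ} {g h : F[X]}
    (hr : r ≠ 0) (hQ : (Q : F) = 0)
    (hadd : (X ^ Q * g + h) ^ r = X ^ Fintype.card F * g ^ r + h ^ r)
    (hs : (X ^ Q * g + h).Splits)
    (hW : X * g ^ r + h ^ r ≠ 0) (hwr : wronskian g h ≠ 0) :
    (X ^ Q * g + h).natDegree ≤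
      (X * g ^ r + h ^ r).natDegree + (wronskian g h).natDegree := by
  classical
  set f := X ^ Q * g + h with hf
  have hmul : (X * g ^ r + h ^ r) * wronskian g h ≠ 0 := mul_ne_zero hW hwr
  have hder : wronskian g f = wronskian g h := by
    have : derivative f = X ^ Q * derivative g + derivative h := by
      simp [hf, derivative_X_pow, hQ]
    rw [wronskian, wronskian, this, hf]
    ring
  have hle : f.roots ≤ ((X * g ^ r + h ^ r) * wronskian g h).roots := by
    rw [Multiset.le_iff_count]
    intro a
    rw [count_roots, count_roots]
    by_cases ha : f.rootMultiplicity a = 0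
    · simp [ha]
    have hroot : f.eval a = 0 := by
      have := rootMultiplicity_pos'.1 (Nat.pos_of_ne_zero ha)
      exact this.2
    have h1 : 1 ≤ (X * g ^ r + h ^ r).rootMultiplicity a := by
      refine (rootMultiplicity_pos hW).2 ?_
      have := congrArg (eval a) hadd
      simp only [eval_pow, hroot, zero_pow hr, eval_add, eval_mul, eval_X,
        FiniteField.pow_card] at this
      simpa [IsRoot] using this.symm
    have h2 : f.rootMultiplicity a - 1 ≤ (wronskian g h).rootMultiplicity a := by
      rw [le_rootMultiplicity_iff hwr, ← hder, wronskian]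
      have hd1 : (X - C a) ^ (f.rootMultiplicity a - 1) ∣ f :=
        (pow_dvd_pow _ (Nat.sub_le _ _)).trans (pow_rootMultiplicity_dvd f a)
      have hd2 : (X - C a) ^ (f.rootMultiplicity a - 1) ∣ derivative f :=
        pow_sub_one_dvd_derivative_of_pow_dvd (pow_rootMultiplicity_dvd f a)
      exact dvd_sub (hd2.mul_left _) (hd1.mul_left _)
    rw [rootMultiplicity_mul hmul]
    omega
  calc f.natDegree = Multiset.card f.roots := hs.natDegree_eq_card_roots
    _ ≤ _ := Multiset.card_le_card hle
    _ ≤ _ := card_roots' _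
    _ ≤ _ := natDegree_mul_le

lemma natDegree_X_mul_pow_add_pow_le {g h : F[X]} {r k : ℕ} (hg : g.natDegree ≤ k)
    (hh : h.natDegree ≤ k) : (X * g ^ r + h ^ r).natDegree ≤ r * k + 1 := by
  have h1 : (g ^ r).natDegree ≤ r * k := natDegree_pow_le_of_le r hg
  have h2 : (h ^ r).natDegree ≤ r * k := natDegree_pow_le_of_le r hh
  refine natDegree_add_le_of_degree_le ?_ (h2.trans (Nat.le_succ _))
  refine natDegree_mul_le.trans ?_
  rw [natDegree_X]
  omega

/-- Coprime `g`, `h` of degree less than `p ^ 2` for which `X ^ (p ^ 3) * g + h` is fully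
reducible over the field with `p ^ 3` elements are constant, unless `h = -X * g`. -/
lemma eq_zero_of_splits_lacunary [Fintype F] {p : ℕ} [Fact p.Prime] [CharP F p]
    (hF : Fintype.card F = p ^ 3) {g h : F[X]} {k : ℕ} (hc : IsCoprime g h)
    (hs : (X ^ p ^ 3 * g + h).Splits) (hdeg : (X ^ p ^ 3 * g + h).natDegree = p ^ 3 + k)
    (hg : g.natDegree ≤ k) (hh : h.natDegree ≤ k) (hk : k < p ^ 2)
    (hW : X * g + h ≠ 0) : k = 0 := by
  have hp : p.Prime := Fact.out
  have hp2 := hp.two_le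
  have hwr : wronskian g h = 0 := by
    by_contra hwr
    have hle := natDegree_le_of_splits_lacunary (Q := p ^ 3) (r := 1) one_ne_zero
      (by simp) (by simp [hF]) hs (by simpa using hW) hwr
    have h1 := natDegree_X_mul_pow_add_pow_le (r := 1) hg hh
    have h2 := natDegree_wronskian_lt_add hwr
    rw [hdeg] at hle
    have : p ^ 3 = p * p ^ 2 := by ring
    nlinarith
  obtain ⟨hg', hh'⟩ := hc.wronskian_eq_zero_iff.1 hwr
  obtain ⟨g₁, rfl⟩ := exists_eq_pow_of_derivative_eq_zero p hg'
  obtain ⟨h₁, rfl⟩ := exists_eq_pow_of_derivative_eq_zero p hh'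
  have hc₁ : IsCoprime g₁ h₁ := (IsCoprime.pow_iff hp.pos hp.pos).1 hc
  have hfrob : X ^ p ^ 3 * g₁ ^ p + h₁ ^ p = (X ^ p ^ 2 * g₁ + h₁) ^ p := by
    rw [add_pow_char, mul_pow, ← pow_mul, ← pow_succ]
  rw [hfrob, natDegree_pow] at hdeg
  rw [hfrob] at hs
  have hne : X ^ p ^ 2 * g₁ + h₁ ≠ 0 := by
    intro h0
    have := pow_pos hp.pos 3
    rw [h0, natDegree_zero] at hdeg
    omega
  obtain ⟨k₁, rfl⟩ : p ∣ k := by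
    have : p ∣ p ^ 3 + k := ⟨_, hdeg.symm⟩
    exact (Nat.dvd_add_right (dvd_pow_self p three_ne_zero)).1 this
  have hdeg₁ : (X ^ p ^ 2 * g₁ + h₁).natDegree = p ^ 2 + k₁ := by
    apply Nat.eq_of_mul_eq_mul_left hp.pos
    rw [hdeg]; ring
  rw [natDegree_pow] at hg hh
  have hg₁ := Nat.le_of_mul_le_mul_left hg hp.pos
  have hh₁ := Nat.le_of_mul_le_mul_left hh hp.pos
  have hk₁ : k₁ < p := by
    rw [sq] at hk
    exact Nat.lt_of_mul_lt_mul_left hk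
  have hs₁ : (X ^ p ^ 2 * g₁ + h₁).Splits :=
    hs.of_dvd (pow_ne_zero _ hne) (dvd_pow_self _ hp.ne_zero)
  have hwr₁ : wronskian g₁ h₁ = 0 := by
    by_contra hwr₁
    have hle := natDegree_le_of_splits_lacunary (Q := p ^ 2) (r := p) hp.ne_zero
      (by simp) (by rw [hF, hfrob]) hs₁ hW hwr₁
    have h1 := natDegree_X_mul_pow_add_pow_le (r := p) hg₁ hh₁
    have h2 := natDegree_wronskian_lt_add hwr₁
    rw [hdeg₁] at hle
    have h3 : k₁ + 1 ≤ p := hk₁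
    nlinarith
  obtain ⟨hg₁', hh₁'⟩ := hc₁.wronskian_eq_zero_iff.1 hwr₁
  obtain ⟨g₂, rfl⟩ := exists_eq_pow_of_derivative_eq_zero p hg₁'
  obtain ⟨h₂, rfl⟩ := exists_eq_pow_of_derivative_eq_zero p hh₁'
  have hfrob₁ : X ^ p ^ 2 * g₂ ^ p + h₂ ^ p = (X ^ p * g₂ + h₂) ^ p := by
    rw [add_pow_char, mul_pow, ← pow_mul, ← sq]
  rw [hfrob₁, natDegree_pow] at hdeg₁
  have hdvd : p ∣ k₁ :=
    (Nat.dvd_add_right (dvd_pow_self p two_ne_zero)).1 ⟨_, hdeg₁.symm⟩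
  rw [Nat.eq_zero_of_dvd_of_lt hdvd hk₁, mul_zero]

/-- A fully reducible lacunary polynomial `X ^ (p ^ 3) * g + h` over the field with `p ^ 3`
elements, with `g` and `h` of degree less than `p ^ 2`, vanishes on the whole field or has a
root of multiplicity at least `p ^ 3`. -/
lemma exists_pow_dvd_of_splits_lacunary [Fintype F] {p : ℕ} [Fact p.Prime] [CharP F p]
    (hF : Fintype.card F = p ^ 3) {g h : F[X]} {k : ℕ}
    (hs : (X ^ p ^ 3 * g + h).Splits) (hdeg : (X ^ p ^ 3 * g + h).natDegree = p ^ 3 + k)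
    (hg : g.natDegree ≤ k) (hh : h.natDegree ≤ k) (hk : k < p ^ 2) :
    (∀ a, (X ^ p ^ 3 * g + h).eval a = 0) ∨
      ∃ a, (X + C a) ^ p ^ 3 ∣ X ^ p ^ 3 * g + h := by
  classical
  have hp : p.Prime := Fact.out
  have hq := pow_pos hp.pos 3
  have hne : X ^ p ^ 3 * g + h ≠ 0 := by
    intro h0
    rw [h0, natDegree_zero] at hdeg
    omega
  have hgh : ¬(g = 0 ∧ h = 0) := by
    rintro ⟨rfl, rfl⟩
    simp at hne
  obtain ⟨d, g₀, h₀, hd0, rfl, rfl, hc⟩ : ∃ d g₀ h₀ : F[X], d ≠ 0 ∧ g = d * g₀ ∧ h = d * h₀ ∧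
      IsCoprime g₀ h₀ := by
    have hd0 : EuclideanDomain.gcd g h ≠ 0 :=
      fun h0 ↦ hgh (EuclideanDomain.gcd_eq_zero_iff.1 h0)
    obtain ⟨g₀, hg₀⟩ := EuclideanDomain.gcd_dvd_left g h
    obtain ⟨h₀, hh₀⟩ := EuclideanDomain.gcd_dvd_right g h
    refine ⟨_, g₀, h₀, hd0, hg₀, hh₀, EuclideanDomain.gcdA g h, EuclideanDomain.gcdB g h, ?_⟩
    have hbez := EuclideanDomain.gcd_eq_gcd_ab g h
    apply mul_left_cancel₀ hd0
    calc _ = EuclideanDomain.gcd g h * g₀ * EuclideanDomain.gcdA g h +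
          EuclideanDomain.gcd g h * h₀ * EuclideanDomain.gcdB g h := by ring
      _ = _ := by rw [← hg₀, ← hh₀, ← hbez, mul_one]
  have hfac : X ^ p ^ 3 * (d * g₀) + d * h₀ = d * (X ^ p ^ 3 * g₀ + h₀) := by ring
  rw [hfac] at hs hdeg hne ⊢
  have hne₀ := right_ne_zero_of_mul hne
  rw [natDegree_mul hd0 hne₀] at hdeg
  have hbound : ∀ u : F[X], (d * u).natDegree ≤ k → d * u ≠ 0 →
      d.natDegree ≤ k ∧ u.natDegree ≤ k - d.natDegree := by
    intro u hu hu0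
    rw [natDegree_mul hd0 (right_ne_zero_of_mul hu0)] at hu
    omega
  have hdk : d.natDegree ≤ k := by
    rcases not_and_or.1 hgh with h0 | h0
    · exact (hbound _ hg h0).1
    · exact (hbound _ hh h0).1
  have hg₀ : g₀.natDegree ≤ k - d.natDegree := by
    by_cases h0 : g₀ = 0
    · simp [h0]
    · exact (hbound _ hg (mul_ne_zero hd0 h0)).2
  have hh₀ : h₀.natDegree ≤ k - d.natDegree := by
    by_cases h0 : h₀ = 0
    · simp [h0]
    · exact (hbound _ hh (mul_ne_zero hd0 h0)).2
  by_cases hW : X * g₀ + h₀ = 0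
  · left
    intro a
    have := congrArg (eval a) hW
    simp only [eval_add, eval_mul, eval_X, eval_zero] at this
    simp [← hF, FiniteField.pow_card, this]
  right
  have hk₀ := eq_zero_of_splits_lacunary hF hc
    (hs.of_dvd hne (dvd_mul_left _ _)) (k := k - d.natDegree) (by omega) hg₀ hh₀ (by omega) hW
  rw [hk₀, Nat.le_zero] at hg₀ hh₀
  rw [eq_C_of_natDegree_eq_zero hg₀, eq_C_of_natDegree_eq_zero hh₀] at hdeg ⊢
  set c := g₀.coeff 0
  set b := h₀.coeff 0
  have hc0 : c ≠ 0 := by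
    intro h0
    rw [h0] at hdeg
    simp at hdeg
    omega
  refine ⟨b / c, Dvd.dvd.mul_left ⟨C c, ?_⟩ d⟩
  rw [add_pow_char_pow, ← C_pow, ← hF, FiniteField.pow_card, add_mul, ← C_mul,
    div_mul_cancel₀ _ hc0]

end Lacunary
section Affine

variable {F : Type*} [Field F]

/-- The Jamison, Brouwer–Schrijver bound: a set of points meeting all lines of the affine plane
over a field with `q` elements has at least `2 * q - 1` points. -/
lemma two_mul_card_sub_one_le_of_affine_blocking [Fintype F] (A : Finset (F × F))
    (hA : ∀ r s t : F, ¬(r = 0 ∧ s = 0) → ∃ P ∈ A, r * P.1 + s * P.2 + t = 0) :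
    2 * Fintype.card F - 1 ≤ A.card := by
  classical
  obtain ⟨O, hO, -⟩ := hA 1 0 0 (by simp)
  let G : MvPolynomial (Fin 2) F := ∏ P ∈ A.erase O,
    (1 + MvPolynomial.C (P.1 - O.1) * MvPolynomial.X 0 +
      MvPolynomial.C (P.2 - O.2) * MvPolynomial.X 1)
  have hcard : (A.erase O).card + 1 = A.card := Finset.card_erase_add_one hO
  have heval : ∀ x : Fin 2 → F, MvPolynomial.eval x G =
      ∏ P ∈ A.erase O, (1 + (P.1 - O.1) * x 0 + (P.2 - O.2) * x 1) := by
    intro x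
    simp [G]
  have hG : G.totalDegree ≤ (A.erase O).card := by
    refine (MvPolynomial.totalDegree_finsetProd _ _).trans ?_
    refine (Finset.sum_le_card_nsmul _ _ 1 fun P _ ↦ ?_).trans (by simp)
    have hlin : ∀ (c : F) (i : Fin 2),
        (MvPolynomial.C c * MvPolynomial.X i).totalDegree ≤ 1 := fun c i ↦
      (MvPolynomial.totalDegree_mul _ _).trans (by simp)
    refine (MvPolynomial.totalDegree_add _ _).trans (max_le ?_ (hlin _ _))
    exact (MvPolynomial.totalDegree_add _ _).trans (max_le (by simp) (hlin _ _))
  by_contra! hlt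
  have hq := Fintype.one_lt_card (α := F)
  have hsum := MvPolynomial.sum_eval_eq_zero G (by rw [Fintype.card_fin]; omega)
  rw [Finset.sum_eq_single 0] at hsum
  · rw [heval] at hsum
    simp at hsum
  · intro x _ hx
    rw [heval, Finset.prod_eq_zero_iff]
    obtain ⟨P, hP, hPx⟩ := hA (x 0) (x 1) (1 - x 0 * O.1 - x 1 * O.2) (by
      rintro ⟨h0, h1⟩
      apply hx
      funext i
      fin_cases i <;> assumption)
    refine ⟨P, Finset.mem_erase.2 ⟨?_, hP⟩, by linear_combination hPx⟩
    rintro rfl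
    exact one_ne_zero (α := F) (by linear_combination hPx)
  · simp

/-- The substitution `X 0 ↦ X * Y`, `X 1 ↦ Y`; the coefficient of `Y ^ j` in the image is the
homogeneous component of degree `j`, dehomogenized. -/
noncomputable def slopeHom : MvPolynomial (Fin 2) F →+* F[X][X] :=
  MvPolynomial.eval₂Hom (C.comp C) ![C X * X, X]

@[simp] lemma slopeHom_C (c : F) : slopeHom (MvPolynomial.C c) = C (C c) := by
  simp [slopeHom]

@[simp] lemma slopeHom_X_zero : slopeHom (F := F) (MvPolynomial.X 0) = C X * X := by
  simp [slopeHom]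

@[simp] lemma slopeHom_X_one : slopeHom (F := F) (MvPolynomial.X 1) = X := by
  simp [slopeHom]

lemma natDegree_slopeHom_le (H : MvPolynomial (Fin 2) F) :
    (slopeHom H).natDegree ≤ H.totalDegree := by
  have hmap : (MvPolynomial.map (C (R := F)) H).totalDegree ≤ H.totalDegree :=
    Finset.sup_mono (MvPolynomial.support_map_subset C H)
  have h := MvPolynomial.aeval_natDegree_le (MvPolynomial.map (C (R := F)) H)
    hmap ![C X * X, X] (n := 1) (by
      intro i
      fin_cases i
      · simp
      · simp)
  simpa [slopeHom, MvPolynomial.aeval_def, MvPolynomial.eval₂_map] using h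

lemma natDegree_coeff_slopeHom_le (H : MvPolynomial (Fin 2) F) (j : ℕ) :
    ((slopeHom H).coeff j).natDegree ≤ j := by
  induction H using MvPolynomial.induction_on generalizing j with
  | C c =>
    rw [slopeHom_C, coeff_C]
    split_ifs <;> simp
  | add p q hp hq =>
    rw [map_add, coeff_add]
    exact natDegree_add_le_of_degree_le (hp j) (hq j)
  | mul_X p i hp =>
    rw [map_mul]
    fin_cases i
    · change ((slopeHom p * slopeHom (MvPolynomial.X 0)).coeff j).natDegree ≤ j
      rw [slopeHom_X_zero, ← mul_assoc]
      cases j with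
      | zero => simp
      | succ j =>
        rw [coeff_mul_X, coeff_mul_C]
        exact natDegree_mul_le.trans (by simpa using hp j)
    · change ((slopeHom p * slopeHom (MvPolynomial.X 1)).coeff j).natDegree ≤ j
      rw [slopeHom_X_one]
      cases j with
      | zero => simp
      | succ j =>
        rw [coeff_mul_X]
        exact (hp j).trans (Nat.le_succ j)

lemma prod_X_sub_C_univ [Fintype F] (i : Fin 2) :
    ∏ r : F, (MvPolynomial.X i - MvPolynomial.C r) =
      (MvPolynomial.X i ^ Fintype.card F - MvPolynomial.X i : MvPolynomial (Fin 2) F) := by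
  have hq := Fintype.one_lt_card (α := F)
  have hmonic : (X ^ Fintype.card F - X : F[X]).Monic :=
    monic_X_pow_sub (by rw [degree_X]; exact_mod_cast hq)
  have hroots : Multiset.card (X ^ Fintype.card F - X : F[X]).roots =
      (X ^ Fintype.card F - X : F[X]).natDegree := by
    rw [FiniteField.roots_X_pow_card_sub_X, FiniteField.X_pow_card_sub_X_natDegree_eq F hq]
    simp
  have h := congrArg (aeval (MvPolynomial.X i : MvPolynomial (Fin 2) F))
    (prod_multiset_X_sub_C_of_monic_of_roots_card_eq hmonic hroots)
  rw [FiniteField.roots_X_pow_card_sub_X] at h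
  simpa [map_prod, MvPolynomial.algebraMap_eq] using h

/-- The Rédei polynomial of a point set meeting every non-vertical affine line is lacunary. -/
lemma exists_lacunary_of_affine_blocking [Fintype F] (A : Finset (F × F))
    (hA : ∀ s t : F, ∃ P ∈ A, s * P.1 + P.2 + t = 0) :
    Fintype.card F ≤ A.card ∧ ∃ g h : F[X],
      g.natDegree ≤ A.card - Fintype.card F ∧ h.natDegree ≤ A.card - Fintype.card F ∧
      ∏ P ∈ A, (X + C P.1) = X ^ Fintype.card F * g + h := by
  classical
  have hq := Fintype.one_lt_card (α := F)
  have hle : Fintype.card F ≤ A.card := by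
    rw [← Finset.card_univ]
    refine Finset.card_le_card_of_surjOn Prod.snd fun b _ ↦ ?_
    obtain ⟨P, hP, h⟩ := hA 0 (-b)
    exact ⟨P, hP, by linear_combination h⟩
  refine ⟨hle, ?_⟩
  let R : MvPolynomial (Fin 2) F := ∏ P ∈ A,
    (MvPolynomial.X 0 + MvPolynomial.C P.1 * MvPolynomial.X 1 + MvPolynomial.C P.2)
  have hR : R.totalDegree ≤ A.card := by
    refine (MvPolynomial.totalDegree_finsetProd _ _).trans ?_
    refine (Finset.sum_le_card_nsmul _ _ 1 fun P _ ↦ ?_).trans (by simp)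
    refine (MvPolynomial.totalDegree_add _ _).trans (max_le ?_ (by simp))
    refine (MvPolynomial.totalDegree_add _ _).trans (max_le (by simp) ?_)
    exact (MvPolynomial.totalDegree_mul _ _).trans (by simp)
  obtain ⟨H, hH, hRH⟩ := MvPolynomial.combinatorial_nullstellensatz_exists_linearCombination
    (fun _ : Fin 2 ↦ (Finset.univ : Finset F)) (fun _ ↦ Finset.univ_nonempty) R (by
      intro x _
      obtain ⟨P, hP, h⟩ := hA (x 1) (x 0)
      simp only [R, MvPolynomial.eval_prod]
      refine Finset.prod_eq_zero hP ?_
      simp only [map_add, map_mul, MvPolynomial.eval_X, MvPolynomial.eval_C]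
      linear_combination h)
  simp only [prod_X_sub_C_univ] at hH hRH
  rw [Finsupp.linearCombination_apply, Finsupp.sum_fintype _ _ (by simp),
    Fin.sum_univ_two, smul_eq_mul, smul_eq_mul] at hRH
  have hdeg : ∀ i, (H i).totalDegree ≤ A.card - Fintype.card F := by
    intro i
    by_cases h0 : H i = 0
    · simp [h0]
    have hX : (MvPolynomial.X i ^ Fintype.card F - MvPolynomial.X i :
        MvPolynomial (Fin 2) F).totalDegree = Fintype.card F := by
      rw [sub_eq_add_neg, MvPolynomial.totalDegree_add_eq_left_of_totalDegree_lt,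
        MvPolynomial.totalDegree_X_pow]
      rwa [MvPolynomial.totalDegree_neg, MvPolynomial.totalDegree_X,
        MvPolynomial.totalDegree_X_pow]
    have hX0 : (MvPolynomial.X i ^ Fintype.card F - MvPolynomial.X i :
        MvPolynomial (Fin 2) F) ≠ 0 := by
      intro h
      rw [h, MvPolynomial.totalDegree_zero] at hX
      omega
    have := (hH i).trans hR
    rw [MvPolynomial.totalDegree_mul_of_isDomain hX0 h0, hX] at this
    omega
  set k := A.card - Fintype.card F with hk
  have hn : A.card = k + Fintype.card F := by omega
  have hcoeff : ∀ i, (slopeHom (H i)).coeff (A.card - 1) = 0 := fun i ↦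
    coeff_eq_zero_of_natDegree_lt
      (((natDegree_slopeHom_le _).trans (hdeg i)).trans_lt (by omega))
  refine ⟨(slopeHom (H 0)).coeff k, (slopeHom (H 1)).coeff k,
    natDegree_coeff_slopeHom_le _ _, natDegree_coeff_slopeHom_le _ _, ?_⟩
  have hlhs : (slopeHom R).coeff A.card = ∏ P ∈ A, (X + C P.1) := by
    have hfac : slopeHom R = ∏ P ∈ A, (C (X + C P.1) * X + C (C P.2)) := by
      simp only [R, map_prod, map_add, map_mul, slopeHom_C, slopeHom_X_zero, slopeHom_X_one]
      refine Finset.prod_congr rfl fun P _ ↦ ?_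
      ring
    rw [hfac]
    have := coeff_prod_of_natDegree_le (s := A)
      (fun P : F × F ↦ C (X + C P.1) * X + C (C P.2)) 1 (fun P _ ↦ natDegree_linear_le)
    rw [mul_one] at this
    rw [this]
    simp [coeff_C]
  obtain ⟨n, hn'⟩ : ∃ n, A.card = n + 1 := ⟨A.card - 1, by omega⟩
  have h0 : (slopeHom (H 0)).coeff n = 0 := by simpa [hn'] using hcoeff 0
  have h1 : (slopeHom (H 1)).coeff n = 0 := by simpa [hn'] using hcoeff 1
  have e0 : (slopeHom (H 0) * (C X * X)).coeff A.card = 0 := by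
    rw [hn', ← mul_assoc, coeff_mul_X, coeff_mul_C, h0, zero_mul]
  have e1 : (slopeHom (H 1) * X).coeff A.card = 0 := by
    rw [hn', coeff_mul_X, h1]
  rw [← hlhs, hRH]
  simp only [map_add, map_mul, map_sub, map_pow, slopeHom_X_zero, slopeHom_X_one, mul_sub,
    coeff_add, coeff_sub, e0, e1, sub_zero]
  rw [mul_pow, ← mul_assoc, hn, coeff_mul_X_pow, coeff_mul_X_pow, ← C_pow, coeff_mul_C]
  ring


/-- A set of points of the affine plane of order `p ^ 3` that meets all non-vertical lines and
contains no vertical line has at least `p ^ 3 + p ^ 2` points. -/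
lemma card_add_sq_le_of_affine_blocking [Fintype F] {p : ℕ} (hp : p.Prime)
    (hF : Fintype.card F = p ^ 3) (A : Finset (F × F))
    (hA : ∀ s t : F, ∃ P ∈ A, s * P.1 + P.2 + t = 0) (hv : ∀ a, ∃ b, (a, b) ∉ A) :
    p ^ 3 + p ^ 2 ≤ A.card := by
  classical
  have : Fact p.Prime := ⟨hp⟩
  have : CharP F p := charP_of_card_eq_prime_pow hF
  obtain ⟨hle, g, h, hg, hh, hfac⟩ := exists_lacunary_of_affine_blocking A hA
  rw [hF] at hle hg hh hfac
  by_contra! hlt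
  have hsplit : (∏ P ∈ A, (X + C P.1) : F[X]).Splits :=
    Splits.prod fun P _ ↦ Splits.X_add_C P.1
  have hdeg : (∏ P ∈ A, (X + C P.1) : F[X]).natDegree = A.card := by
    rw [natDegree_prod_of_monic _ _ fun P _ ↦ monic_X_add_C P.1]
    simp
  have hmonic : (∏ P ∈ A, (X + C P.1) : F[X]).Monic :=
    monic_prod_of_monic _ _ fun P _ ↦ monic_X_add_C P.1
  rcases exists_pow_dvd_of_splits_lacunary (k := A.card - p ^ 3) hF (hfac ▸ hsplit)
    (by rw [← hfac, hdeg]; omega) hg hh (by omega) with hzero | ⟨a, ha⟩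
  · have hall : ∀ a, ∃ P ∈ A, P.1 = a := by
      intro a
      have := hzero (-a)
      rw [← hfac, eval_prod, Finset.prod_eq_zero_iff] at this
      obtain ⟨P, hP, h0⟩ := this
      rw [eval_add, eval_X, eval_C] at h0
      exact ⟨P, hP, by linear_combination h0⟩
    have hJ := two_mul_card_sub_one_le_of_affine_blocking A (by
      intro r s t hrs
      by_cases hs : s = 0
      · have hr : r ≠ 0 := fun hr ↦ hrs ⟨hr, hs⟩
        obtain ⟨P, hP, h0⟩ := hall (-t / r)
        refine ⟨P, hP, ?_⟩
        rw [h0, hs]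
        field_simp
        ring
      · obtain ⟨P, hP, h0⟩ := hA (r / s) (t / s)
        refine ⟨P, hP, ?_⟩
        field_simp at h0
        linear_combination h0)
    rw [hF] at hJ
    have := hp.two_le
    have : 2 * p ^ 2 ≤ p ^ 3 := by
      rw [pow_succ p 2, mul_comm]
      exact Nat.mul_le_mul_left _ this
    have := pow_pos hp.pos 2
    omega
  · rw [← hfac, ← sub_neg_eq_add, ← C_neg, ← le_rootMultiplicity_iff hmonic.ne_zero,
      ← count_roots] at ha
    have hroots : (∏ P ∈ A, (X + C P.1) : F[X]).roots = A.val.map fun P ↦ -P.1 := by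
      rw [← roots_multiset_prod_X_sub_C (A.val.map fun P ↦ -P.1), Multiset.map_map]
      rw [← Finset.prod_map_val]
      simp
    rw [hroots, Multiset.count_map] at ha
    obtain ⟨b, hb⟩ := hv a
    have hcard : Fintype.card F ≤ (A.filter fun P ↦ -a = -P.1).card := by
      rw [hF]
      exact ha
    have himg : ((A.filter fun P ↦ -a = -P.1).image Prod.snd) = Finset.univ := by
      rw [← Finset.card_eq_iff_eq_univ]
      refine le_antisymm (Finset.card_le_univ _) ?_
      rw [Finset.card_image_of_injOn]
      · exact hcard
      · rintro ⟨x, y⟩ hx ⟨x', y'⟩ hx' (rfl : y = y')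
        simp only [Finset.coe_filter, Set.mem_ofPred_eq, neg_inj] at hx hx'
        rw [← hx.2, ← hx'.2]
    have hbm : b ∈ (A.filter fun P ↦ -a = -P.1).image Prod.snd := himg ▸ Finset.mem_univ b
    simp only [Finset.mem_image, Finset.mem_filter, neg_inj] at hbm
    obtain ⟨⟨x, y⟩, ⟨hxy, rfl⟩, rfl⟩ := hbm
    exact hb hxy

end Affine

section Projective

variable {F V : Type*} [Field F] [AddCommGroup V] [Module F V]

/-- Every line, that is, every 2-dimensional subspace, contains a member of `B`. -/
def Blocks (B : Set (Submodule F V)) : Prop :=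
  ∀ L : Submodule F V, finrank F L = 2 → ∃ P ∈ B, P ≤ L

/-- A finite blocking set contains a blocking set having a tangent line. -/
lemma exists_tangent_of_blocks {B : Set (Submodule F V)} (hfin : B.Finite) (hB : Blocks B)
    (hL : ∃ L : Submodule F V, finrank F L = 2) :
    ∃ B' ⊆ B, Blocks B' ∧ ∃ P ∈ B', ∃ L : Submodule F V, finrank F L = 2 ∧ P ≤ L ∧
      ∀ Q ∈ B', Q ≤ L → Q = P := by
  have hfin' : {C | C ⊆ B ∧ Blocks C}.Finite :=
    hfin.finite_subsets.subset fun C hC ↦ hC.1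
  obtain ⟨B', hB'B, hmin⟩ := hfin'.exists_le_minimal (a := B) ⟨subset_rfl, hB⟩
  obtain ⟨L₀, hL₀⟩ := hL
  obtain ⟨P, hP, -⟩ := hmin.prop.2 L₀ hL₀
  have hnot : ¬Blocks (B' \ {P}) := fun h ↦
    (hmin.le_of_le ⟨Set.sdiff_subset.trans hB'B, h⟩ Set.sdiff_subset hP).2 rfl
  simp only [Blocks, not_forall, not_exists, not_and] at hnot
  obtain ⟨L, hL, hLP⟩ := hnot
  have huniq : ∀ Q ∈ B', Q ≤ L → Q = P := by
    intro Q hQ hQL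
    by_contra hne
    exact hLP Q ⟨hQ, hne⟩ hQL
  obtain ⟨Q, hQ, hQL⟩ := hmin.prop.2 L hL
  exact ⟨B', hB'B, hmin.prop.2, P, hP, L, hL, huniq Q hQ hQL ▸ hQL, huniq⟩

lemma exists_span_eq {P : Submodule F V} (hP : finrank F P = 1) : ∃ x ≠ 0, P = F ∙ x := by
  obtain ⟨u, hu0, hu⟩ := finrank_eq_one_iff'.1 hP
  refine ⟨u, by simpa using hu0, le_antisymm ?_ ?_⟩
  · intro x hx
    obtain ⟨c, hc⟩ := hu ⟨x, hx⟩
    exact Submodule.mem_span_singleton.2 ⟨c, congrArg Subtype.val hc⟩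
  · rw [Submodule.span_singleton_le_iff_mem]
    exact u.2

/-- An incident point-line pair of a projective plane can be moved to infinity by a choice of
basis. -/
lemma exists_basis_of_flag (hV : finrank F V = 3) {P L : Submodule F V} (hP : finrank F P = 1)
    (hL : finrank F L = 2) (hPL : P ≤ L) :
    ∃ b : Basis (Fin 3) F V, P = F ∙ b 2 ∧ b 1 ∈ L ∧ b 2 ∈ L := by
  have : FiniteDimensional F V := FiniteDimensional.of_finrank_pos (by omega)
  obtain ⟨u, hu0, rfl⟩ := exists_span_eq hP
  have huL : u ∈ L := hPL (Submodule.mem_span_singleton_self u)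
  obtain ⟨v, hvL, hvP⟩ : ∃ v ∈ L, v ∉ F ∙ u := by
    refine SetLike.exists_of_lt (lt_of_le_of_ne hPL ?_)
    rintro rfl
    omega
  obtain ⟨w, hw⟩ : ∃ w, w ∉ L := by
    by_contra! h
    rw [Submodule.eq_top_iff'.2 h, finrank_top, hV] at hL
    omega
  have hli : LinearIndependent F ![w, v, u] := by
    refine linearIndependent_finCons.2 ⟨linearIndependent_finCons.2 ⟨?_, ?_⟩, ?_⟩
    · exact linearIndependent_unique_iff.2 (by simpa using hu0)
    · simpa using hvP
    · intro h
      refine hw (Submodule.span_le.2 ?_ h)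
      rintro _ ⟨i, rfl⟩
      fin_cases i
      · exact hvL
      · exact huL
  refine ⟨basisOfLinearIndependentOfCardEqFinrank hli (by simp [hV]), ?_, ?_, ?_⟩
  · simp
  · simpa using hvL
  · simpa using huL

/-- The point with affine coordinates `(a, c)` in the chart given by a basis. -/
def affinePoint (b : Basis (Fin 3) F V) (P : F × F) : Submodule F V :=
  F ∙ (b 0 + P.1 • b 1 + P.2 • b 2)

lemma affinePoint_injective (b : Basis (Fin 3) F V) : Function.Injective (affinePoint b) := by
  rintro ⟨a, c⟩ ⟨a', c'⟩ h
  have hmem : b 0 + a • b 1 + c • b 2 ∈ affinePoint b (a', c') := by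
    rw [← h]
    exact Submodule.mem_span_singleton_self _
  obtain ⟨r, hr⟩ := Submodule.mem_span_singleton.1 hmem
  have h0 := congrArg (b.coord 0) hr
  have h1 := congrArg (b.coord 1) hr
  have h2 := congrArg (b.coord 2) hr
  simp at h0 h1 h2
  subst h0
  simp_all

/-- The line whose equation has coefficients `c` in the coordinates given by a basis. -/
noncomputable def lineOf (b : Basis (Fin 3) F V) (c : Fin 3 → F) : Submodule F V :=
  LinearMap.ker (∑ i, c i • b.coord i)

lemma mem_lineOf {b : Basis (Fin 3) F V} {c : Fin 3 → F} {x : V} :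
    x ∈ lineOf b c ↔ c 0 * b.coord 0 x + c 1 * b.coord 1 x + c 2 * b.coord 2 x = 0 := by
  simp [lineOf, Fin.sum_univ_three]

lemma finrank_lineOf (b : Basis (Fin 3) F V) {c : Fin 3 → F} (hc : c ≠ 0) :
    finrank F (lineOf b c) = 2 := by
  have := b.finiteDimensional_of_finite
  have hne : (∑ i, c i • b.coord i : V →ₗ[F] F) ≠ 0 := by
    intro h
    apply hc
    funext i
    have := LinearMap.congr_fun h (b i)
    fin_cases i <;> simpa [Fin.sum_univ_three, Finsupp.single_apply] using this
  have h := Module.Dual.finrank_ker_add_one_of_ne_zero (f := ∑ i, c i • b.coord i) hne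
  rw [finrank_eq_card_basis b, Fintype.card_fin] at h
  rw [lineOf]
  omega

lemma sum_coord_smul (b : Basis (Fin 3) F V) (x : V) :
    b.coord 0 x • b 0 + b.coord 1 x • b 1 + b.coord 2 x • b 2 = x := by
  have := b.sum_repr x
  rwa [Fin.sum_univ_three] at this

/-- A point off the line at infinity is an affine point. -/
lemma span_eq_affinePoint (b : Basis (Fin 3) F V) {x : V} (hx : b.coord 0 x ≠ 0) :
    (F ∙ x) = affinePoint b (b.coord 1 x / b.coord 0 x, b.coord 2 x / b.coord 0 x) := by
  rw [affinePoint, ← Submodule.span_singleton_smul_eq (IsUnit.mk0 _ hx) (b 0 + _ + _)]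
  congr 2
  conv_lhs => rw [← sum_coord_smul b x]
  simp only [smul_add, smul_smul, mul_div_cancel₀ _ hx]

end Projective

end BlockingSet

open BlockingSet in
/-- Blokhuis, 1994: a blocking set of `PG(2,p³)`, `p` prime, not containing a line,
has at least `p³ + p² + 1` points. -/
theorem blocking_set_cube_plane (p : ℕ) (hp : p.Prime)
    (F : Type) [Field F] [Fintype F] (hF : Fintype.card F = p ^ 3)
    (B : Set (Submodule F (Fin 3 → F)))
    (hBpts : ∀ P ∈ B, finrank F P = 1)
    (hblock : ∀ L : Submodule F (Fin 3 → F), finrank F L = 2 → ∃ P ∈ B, P ≤ L)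
    (hnoline : ∀ L : Submodule F (Fin 3 → F), finrank F L = 2 →
      ∃ P : Submodule F (Fin 3 → F), finrank F P = 1 ∧ P ≤ L ∧ P ∉ B) :
    B.ncard ≥ p ^ 3 + p ^ 2 + 1 := by
  classical
  have : Finite (Submodule F (Fin 3 → F)) :=
    Finite.of_injective (fun L ↦ (L : Set (Fin 3 → F))) SetLike.coe_injective
  obtain ⟨B', hB', hblock', P, hP, L, hL, hPL, huniq⟩ :=
    exists_tangent_of_blocks B.toFinite hblock
      ⟨_, finrank_lineOf (Pi.basisFun F (Fin 3)) (c := 1) one_ne_zero⟩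
  obtain ⟨b, hPb, hb1, hb2⟩ :=
    exists_basis_of_flag (by simp) (hBpts P (hB' hP)) hL hPL
  let A : Finset (F × F) := {Q | affinePoint b Q ∈ B'}
  have hmemA : ∀ Q, Q ∈ A ↔ affinePoint b Q ∈ B' := by simp [A]
  have hcard := card_add_sq_le_of_affine_blocking hp hF A (by
      intro s t
      obtain ⟨Q, hQ, hQl⟩ := hblock' (lineOf b ![t, s, 1])
        (finrank_lineOf b fun h ↦ one_ne_zero (α := F) (congrFun h 2))
      obtain ⟨x, hx0, rfl⟩ := exists_span_eq (hBpts Q (hB' hQ))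
      have hx := mem_lineOf.1 (hQl (Submodule.mem_span_singleton_self x))
      simp only [Matrix.cons_val] at hx
      have hx0 : b.coord 0 x ≠ 0 := by
        intro h0
        have hxL : x ∈ L := by
          rw [← sum_coord_smul b x, h0, zero_smul, zero_add]
          exact L.add_mem (L.smul_mem _ hb1) (L.smul_mem _ hb2)
        have hxP := huniq _ hQ ((Submodule.span_singleton_le_iff_mem _ _).2 hxL)
        have hbl : b 2 ∈ lineOf b ![t, s, 1] := by
          apply hQl
          rw [hxP, hPb]
          exact Submodule.mem_span_singleton_self _
        simp [mem_lineOf] at hbl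
      refine ⟨(b.coord 1 x / b.coord 0 x, b.coord 2 x / b.coord 0 x), ?_, ?_⟩
      · rwa [hmemA, ← span_eq_affinePoint b hx0]
      · field_simp
        linear_combination hx) (by
      intro a
      by_contra! ha
      obtain ⟨Q, hQ1, hQl, hQB⟩ := hnoline (lineOf b ![-a, 1, 0])
        (finrank_lineOf b fun h ↦ one_ne_zero (α := F) (congrFun h 1))
      obtain ⟨x, hx0, rfl⟩ := exists_span_eq hQ1
      have hx := mem_lineOf.1 (hQl (Submodule.mem_span_singleton_self x))
      simp only [Matrix.cons_val] at hx
      by_cases h0 : b.coord 0 x = 0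
      · have h1 : b.coord 1 x = 0 := by linear_combination hx + a * h0
        have hx2 := sum_coord_smul b x
        rw [h0, h1, zero_smul, zero_smul, zero_add, zero_add] at hx2
        have h2 : b.coord 2 x ≠ 0 := by
          intro h2
          rw [h2, zero_smul] at hx2
          exact hx0 hx2.symm
        apply hQB
        rw [← hx2, Submodule.span_singleton_smul_eq (IsUnit.mk0 _ h2), ← hPb]
        exact hB' hP
      · apply hQB
        rw [span_eq_affinePoint b h0]
        have h1 : b.coord 1 x / b.coord 0 x = a := by
          field_simp
          linear_combination hx
        rw [h1]
        exact hB' ((hmemA _).1 (ha _)))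
  have hPA : P ∉ affinePoint b '' (A : Set (F × F)) := by
    rintro ⟨Q, -, hQ⟩
    have hmem : b 0 + Q.1 • b 1 + Q.2 • b 2 ∈ F ∙ b 2 := by
      rw [← hPb, ← hQ]
      exact Submodule.mem_span_singleton_self _
    obtain ⟨r, hr⟩ := Submodule.mem_span_singleton.1 hmem
    have := congrArg (b.coord 0) hr
    simp at this
  have hsub : insert P (affinePoint b '' (A : Set (F × F))) ⊆ B := by
    rintro _ (rfl | ⟨Q, hQ, rfl⟩)
    · exact hB' hP
    · exact hB' ((hmemA Q).1 hQ)
  calc p ^ 3 + p ^ 2 + 1 ≤ A.card + 1 := Nat.succ_le_succ hcard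
    _ = (insert P (affinePoint b '' (A : Set (F × F)))).ncard := by
      rw [Set.ncard_insert_of_notMem hPA (Set.toFinite _),
        Set.ncard_image_of_injective _ (affinePoint_injective b), Set.ncard_coe_finset]
    _ ≤ B.ncard := Set.ncard_le_ncard hsub (Set.toFinite _)
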